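/- arXiv:math/0607503 — 2 statements merged into one kernel-verified Lean document; each statement's English description precedes it below -/
import Mathlib

section
/- The map g : ℂ² → ℙ¹ defined by g(x, y) = [x y : x² + y²] for (x, y) ≠ (0, 0) and g(0, 0) = [0 : 1] is separately holomorphic: for every fixed y₀ ∈ ℂ the map x ↦ g(x, y₀) is holomorphic on ℂ, and for every fixed x₀ ∈ ℂ the map y ↦ g(x₀, y) is holomorphic on ℂ. -/
/-- A coordinate `k`-plane in `ℂⁿ`: the affine subspace obtained by fixing `n - k`
of the coordinates at constant values. -/
def IsCoordPlane (n k : ℕ) (P : Set (Fin n → ℂ)) : Prop :=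
  ∃ (I : Finset (Fin n)) (c : Fin n → ℂ), I.card = n - k ∧
    P = {z | ∀ i ∈ I, z i = c i}

/-- A map `f` from a subset `S` of a complex normed space to the complex projective
space `ℙ^m` is holomorphic on `S` if every point of `S` has an open neighbourhood `U`
and a holomorphic map `F : U → ℂ^{m+1} \ {0}` such that `f z = [F z]` for all
`z ∈ U ∩ S`. -/
def IsHolomorphicOnP {E : Type} [NormedAddCommGroup E] [NormedSpace ℂ E] {m : ℕ}
    (S : Set E) (f : E → Projectivization ℂ (Fin (m + 1) → ℂ)) : Prop :=
  ∀ z ∈ S, ∃ U : Set E, IsOpen U ∧ z ∈ U ∧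
    ∃ (F : E → (Fin (m + 1) → ℂ)) (hF : ∀ w ∈ U, F w ≠ 0),
      DifferentiableOn ℂ F U ∧
      ∀ w (hw : w ∈ U), w ∈ S → f w = Projectivization.mk ℂ (F w) (hF w hw)


/-- The map `g : ℂ² → ℙ¹` with `g (x, y) = [x y : x² + y²]` for `(x, y) ≠ (0, 0)` and
`g (0, 0) = [0 : 1]`. -/
noncomputable def gSep (p : ℂ × ℂ) : Projectivization ℂ (Fin 2 → ℂ) :=
  if hp : p = (0, 0) then
    Projectivization.mk ℂ ![0, 1] (by
      intro hc
      have h1 := congrFun hc 1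
      simp at h1)
  else
    Projectivization.mk ℂ ![p.1 * p.2, p.1 ^ 2 + p.2 ^ 2] (by
      intro hc
      have h0 : p.1 * p.2 = 0 := by simpa using congrFun hc 0
      have h1 : p.1 ^ 2 + p.2 ^ 2 = 0 := by simpa using congrFun hc 1
      apply hp
      rcases mul_eq_zero.mp h0 with h | h
      · have : p.2 = 0 := by
          have : p.2 ^ 2 = 0 := by rw [h] at h1; simpa using h1
          exact pow_eq_zero_iff two_ne_zero |>.mp this
        exact Prod.ext h this
      · have : p.1 = 0 := by
          have : p.1 ^ 2 = 0 := by rw [h] at h1; simpa using h1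
          exact pow_eq_zero_iff two_ne_zero |>.mp this
        exact Prod.ext this h)

theorem mul_sq_add_sq_ne_zero {p : ℂ × ℂ} (hp : p ≠ (0, 0)) :
    (![p.1 * p.2, p.1 ^ 2 + p.2 ^ 2] : Fin 2 → ℂ) ≠ 0 := by
  intro hc
  have h0 : p.1 * p.2 = 0 := by simpa using congrFun hc 0
  have h1 : p.1 ^ 2 + p.2 ^ 2 = 0 := by simpa using congrFun hc 1
  apply hp
  rcases mul_eq_zero.mp h0 with h | h <;> simp_all [Prod.ext_iff]

theorem zero_one_ne_zero : (![0, 1] : Fin 2 → ℂ) ≠ 0 := fun hc => by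
  simpa using congrFun hc 1

theorem gSep_of_ne {p : ℂ × ℂ} (hp : p ≠ (0, 0)) :
    gSep p = Projectivization.mk ℂ ![p.1 * p.2, p.1 ^ 2 + p.2 ^ 2]
      (mul_sq_add_sq_ne_zero hp) := by
  rw [gSep, dif_neg hp]

theorem gSep_zero_right (x : ℂ) :
    gSep (x, 0) = Projectivization.mk ℂ ![0, 1] zero_one_ne_zero := by
  by_cases hx : x = 0
  · rw [gSep, dif_pos (by rw [hx])]
  · rw [gSep_of_ne (by simpa using hx), Projectivization.mk_eq_mk_iff']
    exact ⟨x ^ 2, by simp⟩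

theorem gSep_swap (x y : ℂ) : gSep (x, y) = gSep (y, x) := by
  by_cases h : (x, y) = (0, 0)
  · obtain ⟨rfl, rfl⟩ := Prod.mk.inj h
    rfl
  · have h' : (y, x) ≠ (0, 0) := fun e => h (by simp_all)
    simp only [gSep_of_ne h, gSep_of_ne h', mul_comm x y, add_comm (x ^ 2)]

theorem isHolomorphicOnP_gSep_fst (y : ℂ) :
    IsHolomorphicOnP Set.univ (fun x : ℂ => gSep (x, y)) := by
  intro z _
  refine ⟨Set.univ, isOpen_univ, Set.mem_univ z, ?_⟩
  by_cases hy : y = 0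
  · subst hy
    exact ⟨fun _ => ![0, 1], fun _ _ => zero_one_ne_zero, differentiableOn_const _,
      fun w _ _ => gSep_zero_right w⟩
  · have hne (w : ℂ) : (w, y) ≠ (0, 0) := by simp [hy]
    refine ⟨fun w => ![w * y, w ^ 2 + y ^ 2], fun w _ => mul_sq_add_sq_ne_zero (hne w), ?_,
      fun w _ _ => gSep_of_ne (hne w)⟩
    rw [differentiableOn_pi]
    intro i
    fin_cases i <;> simp <;> fun_prop

/-- The map `g (x, y) = [x y : x² + y²]`, `g (0, 0) = [0 : 1]`, is separately
holomorphic: for each fixed `y₀` the map `x ↦ g (x, y₀)` is holomorphic on `ℂ`, and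
for each fixed `x₀` the map `y ↦ g (x₀, y)` is holomorphic on `ℂ`. -/
theorem gSep_separately_holomorphic :
    (∀ y₀ : ℂ, IsHolomorphicOnP Set.univ (fun x : ℂ => gSep (x, y₀))) ∧
    (∀ x₀ : ℂ, IsHolomorphicOnP Set.univ (fun y : ℂ => gSep (x₀, y))) := by
  exact ⟨isHolomorphicOnP_gSep_fst, fun x₀ => by
    simpa only [gSep_swap x₀] using isHolomorphicOnP_gSep_fst x₀⟩
end

section
/- Let n ≥ 3, let Ω be an open domain in ℂⁿ, and let f : Ω → ℙ^m be a map such that the restriction of f to Ω ∩ Π² is holomorphic for every coordinate 2-plane Π² in ℂⁿ. Then for every k with 3 ≤ k ≤ n and every coordinate k-plane Π^k in ℂⁿ, the restriction of f to Ω ∩ Π^k is holomorphic. -/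
open Filter Topology Set Metric

/-- A bounded holomorphic function on a disc differs from its first order Taylor polynomial by a
uniformly controlled quadratic term. -/
theorem norm_sub_sub_mul_deriv_le {f : ℂ → ℂ} {c z : ℂ} {R M : ℝ}
    (hd : DifferentiableOn ℂ f (ball c R)) (hM : ∀ x ∈ ball c R, ‖f x‖ ≤ M)
    (hz : z ∈ ball c R) :
    ‖f z - f c - (z - c) * deriv f c‖ ≤ 4 * M / R ^ 2 * ‖z - c‖ ^ 2 := by
  have hR : 0 < R := pos_of_mem_ball hz
  have hc : c ∈ ball c R := mem_ball_self hR
  have h1 : ∀ x ∈ ball c R, ‖dslope f c x‖ ≤ 2 * M / R := by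
    intro x hx
    refine Complex.norm_dslope_le_div_of_mapsTo_ball hd (fun y hy => ?_) hx
    rw [mem_closedBall, dist_eq_norm]
    linarith [norm_sub_le (f y) (f c), hM y hy, hM c hc]
  have hd' : DifferentiableOn ℂ (dslope f c) (ball c R) :=
    (Complex.differentiableOn_dslope (isOpen_ball.mem_nhds hc)).2 hd
  have h2 : dist (dslope f c z) (dslope f c c) ≤ 4 * M / R / R * dist z c := by
    refine Complex.dist_le_div_mul_dist_of_mapsTo_ball hd' (fun y hy => ?_) hz
    rw [mem_closedBall, dist_eq_norm]
    have : 4 * M / R = 2 * M / R + 2 * M / R := by ring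
    linarith [norm_sub_le (dslope f c y) (dslope f c c), h1 y hy, h1 c hc]
  have h3 : f z - f c - (z - c) * deriv f c = (z - c) * (dslope f c z - dslope f c c) := by
    rw [dslope_same, mul_sub, ← smul_eq_mul (z - c) (dslope f c z), sub_smul_dslope]
  rw [h3, norm_mul]
  rw [dist_eq_norm, dist_eq_norm] at h2
  calc ‖z - c‖ * ‖dslope f c z - dslope f c c‖ ≤ ‖z - c‖ * (4 * M / R / R * ‖z - c‖) := by gcongr
    _ = _ := by field_simp

theorem norm_div_sub_deriv_le {f : ℂ → ℂ} {c h : ℂ} {R M : ℝ}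
    (hd : DifferentiableOn ℂ f (ball c R)) (hM : ∀ x ∈ ball c R, ‖f x‖ ≤ M)
    (hh : ‖h‖ < R) (h0 : h ≠ 0) :
    ‖(f (c + h) - f c) / h - deriv f c‖ ≤ 4 * M / R ^ 2 * ‖h‖ := by
  have := norm_sub_sub_mul_deriv_le hd hM (z := c + h) (by simpa using hh)
  rw [add_sub_cancel_left] at this
  have h4 : (f (c + h) - f c) / h - deriv f c = (f (c + h) - f c - h * deriv f c) / h := by
    field_simp
  rw [h4, norm_div, div_le_iff₀ (norm_pos_iff.2 h0)]
  linarith [this, sq (‖h‖)]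

/-- The derivative in the first variable depends continuously on the second one. -/
theorem continuousAt_deriv_of_bounded {E : Type*} [TopologicalSpace E] {g : ℂ → E → ℂ}
    {x₀ : ℂ} {w₀ : E} {R M : ℝ} (hR : 0 < R)
    (hx : ∀ᶠ w in 𝓝 w₀, DifferentiableOn ℂ (g · w) (ball x₀ R) ∧ ∀ x ∈ ball x₀ R, ‖g x w‖ ≤ M)
    (hw : ∀ x ∈ ball x₀ R, ContinuousAt (g x) w₀) :
    ContinuousAt (fun w => deriv (g · w) x₀) w₀ := by
  refine continuousAt_of_locally_uniform_approx_of_continuousAt fun u hu => ?_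
  obtain ⟨ε, hε, hεu⟩ := Metric.mem_uniformity_dist.1 hu
  obtain ⟨h, h0, hhR, hhε⟩ : ∃ h : ℂ, h ≠ 0 ∧ ‖h‖ < R ∧ 4 * M / R ^ 2 * ‖h‖ < ε := by
    have h1 : ∀ᶠ h in 𝓝 (0 : ℂ), ‖h‖ < R ∧ 4 * M / R ^ 2 * ‖h‖ < ε := by
      refine (ContinuousAt.eventually_lt (by fun_prop) (by fun_prop) (by simpa)).and
        (ContinuousAt.eventually_lt (by fun_prop) (by fun_prop) (by simpa))
    have h2 := (h1.filter_mono (nhdsWithin_le_nhds (s := {0}ᶜ))).and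
      (eventually_mem_nhdsWithin (s := {0}ᶜ))
    obtain ⟨h, h3, h4⟩ := h2.exists
    exact ⟨h, h4, h3⟩
  refine ⟨_, hx, fun w => (g (x₀ + h) w - g x₀ w) / h, ?_, fun w hw => hεu ?_⟩
  · exact ((hw _ (by simpa)).sub (hw _ (mem_ball_self hR))).div_const h
  · rw [dist_comm, dist_eq_norm]
    exact (norm_div_sub_deriv_le hw.1 hw.2 hhR h0).trans_lt hhε

/-- A bounded function which is holomorphic in each of two groups of variables is jointly
differentiable. -/
theorem differentiableAt_of_separately {E : Type*} [NormedAddCommGroup E] [NormedSpace ℂ E]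
    {g : ℂ → E → ℂ} {x₀ : ℂ} {w₀ : E} {R M : ℝ} (hR : 0 < R)
    (hx : ∀ᶠ w in 𝓝 w₀, DifferentiableOn ℂ (g · w) (ball x₀ R) ∧ ∀ x ∈ ball x₀ R, ‖g x w‖ ≤ M)
    (hw : ∀ x ∈ ball x₀ R, DifferentiableAt ℂ (g x) w₀) :
    DifferentiableAt ℂ (fun p : ℂ × E => g p.1 p.2) (x₀, w₀) := by
  have hcont := continuousAt_deriv_of_bounded hR hx fun x hx => (hw x hx).continuousAt
  have hD := (hw x₀ (mem_ball_self hR)).hasFDerivAt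
  set D := fderiv ℂ (g x₀) w₀
  set d : E → ℂ := fun w => deriv (g · w) x₀ with hd
  refine HasFDerivAt.differentiableAt (f' := (ContinuousLinearMap.fst ℂ ℂ E).smulRight (d w₀) +
    D.comp (ContinuousLinearMap.snd ℂ ℂ E)) ?_
  rw [hasFDerivAt_iff_isLittleO]
  have t1 : (fun p : ℂ × E => g p.1 p.2 - g x₀ p.2 - (p.1 - x₀) * d p.2)
      =o[𝓝 (x₀, w₀)] fun p => p - (x₀, w₀) := by
    have h1 : (fun p : ℂ × E => g p.1 p.2 - g x₀ p.2 - (p.1 - x₀) * d p.2)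
        =O[𝓝 (x₀, w₀)] fun p => ‖p.1 - x₀‖ ^ 2 := by
      refine Asymptotics.IsBigO.of_bound (4 * M / R ^ 2) ?_
      have e1 : ∀ᶠ p : ℂ × E in 𝓝 (x₀, w₀), p.1 ∈ ball x₀ R :=
        continuousAt_fst.eventually (isOpen_ball.mem_nhds (mem_ball_self hR))
      have e2 := (continuousAt_snd (p := (x₀, w₀))).eventually hx
      filter_upwards [e1, e2] with p h1 h2
      simpa using norm_sub_sub_mul_deriv_le h2.1 h2.2 h1
    refine h1.trans_isLittleO ?_
    have h2 : (fun p : ℂ × E => ‖p.1 - x₀‖ ^ 2) =O[𝓝 (x₀, w₀)] fun p => ‖p - (x₀, w₀)‖ ^ 2 := by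
      refine Asymptotics.IsBigO.pow (Asymptotics.IsBigO.of_bound 1 (Eventually.of_forall ?_)) 2
      intro p
      simpa using norm_fst_le (p - (x₀, w₀))
    refine h2.trans_isLittleO ?_
    exact Asymptotics.isLittleO_norm_right.1
      ((Asymptotics.isLittleO_pow_sub_sub (x₀, w₀) (one_lt_two)).norm_right)
  have t2 : (fun p : ℂ × E => (p.1 - x₀) * (d p.2 - d w₀))
      =o[𝓝 (x₀, w₀)] fun p => p - (x₀, w₀) := by
    have h1 : (fun p : ℂ × E => d p.2 - d w₀) =o[𝓝 (x₀, w₀)] fun _ => (1 : ℝ) := by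
      rw [Asymptotics.isLittleO_one_iff]
      have : Tendsto (fun p : ℂ × E => d p.2) (𝓝 (x₀, w₀)) (𝓝 (d w₀)) :=
        hcont.tendsto.comp continuousAt_snd
      simpa using this.sub_const (d w₀)
    have h2 : (fun p : ℂ × E => p.1 - x₀) =O[𝓝 (x₀, w₀)] fun p => ‖p - (x₀, w₀)‖ := by
      refine Asymptotics.IsBigO.of_bound 1 (Eventually.of_forall ?_)
      intro p
      simpa using norm_fst_le (p - (x₀, w₀))
    have h3 := h2.mul_isLittleO h1
    simpa only [mul_one, Asymptotics.isLittleO_norm_right] using h3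
  have t3 : (fun p : ℂ × E => g x₀ p.2 - g x₀ w₀ - D (p.2 - w₀))
      =o[𝓝 (x₀, w₀)] fun p => p - (x₀, w₀) := by
    have h1 := (hasFDerivAt_iff_isLittleO.1 hD).comp_tendsto
      (continuousAt_snd (p := (x₀, w₀))).tendsto
    refine h1.trans_isBigO (Asymptotics.IsBigO.of_bound 1 (Eventually.of_forall ?_))
    intro p
    simpa using norm_snd_le (p - (x₀, w₀))
  refine ((t1.add t2).add t3).congr_left fun p => ?_
  simp
  ring

/-- If `φ` is holomorphic in each variable on `U × V` and bounded on `V` locally uniformly in the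
first variable, then so are its iterated derivatives in the first variable. -/
theorem separately_iteratedDeriv {φ : ℂ → ℂ → ℂ} {U V : Set ℂ} (hV : IsOpen V)
    (hx : ∀ y ∈ V, DifferentiableOn ℂ (φ · y) U) (hy : ∀ x ∈ U, DifferentiableOn ℂ (φ x) V)
    (hb : ∀ x ∈ U, ∃ ε > 0, ∃ M, ball x ε ⊆ U ∧ ∀ x' ∈ ball x ε, ∀ y ∈ V, ‖φ x' y‖ ≤ M) (n : ℕ) :
    (∀ y ∈ V, DifferentiableOn ℂ (iteratedDeriv n (φ · y)) U) ∧
      (∀ x ∈ U, DifferentiableOn ℂ (fun y => iteratedDeriv n (φ · y) x) V) ∧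
      ∀ x ∈ U, ∃ ε > 0, ∃ M, ball x ε ⊆ U ∧
        ∀ x' ∈ ball x ε, ∀ y ∈ V, ‖iteratedDeriv n (φ · y) x'‖ ≤ M := by
  induction n with
  | zero => simpa using ⟨hx, hy, by simpa using hb⟩
  | succ n ih =>
    obtain ⟨ix, iy, ib⟩ := ih
    have hU : IsOpen U := by
      rw [Metric.isOpen_iff]
      intro x hx
      obtain ⟨ε, hε, _, h, _⟩ := hb x hx
      exact ⟨ε, hε, h⟩
    simp only [iteratedDeriv_succ]
    refine ⟨fun y hy => (ix y hy).deriv hU, fun x hx => ?_, fun x hx => ?_⟩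
    · obtain ⟨ε, hε, M, hεU, hM⟩ := ib x hx
      set ψ : ℂ → ℂ → ℂ := fun x y => iteratedDeriv n (φ · y) x
      have key : TendstoUniformlyOn (fun (h y : ℂ) => (ψ (x + h) y - ψ x y) / h)
          (fun y => deriv (ψ · y) x) (𝓝[≠] 0) V := by
        rw [Metric.tendstoUniformlyOn_iff]
        intro δ hδ
        have h1 : ∀ᶠ h in 𝓝 (0 : ℂ), ‖h‖ < ε ∧ 4 * M / ε ^ 2 * ‖h‖ < δ := by
          refine (ContinuousAt.eventually_lt (by fun_prop) (by fun_prop) (by simpa)).and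
            (ContinuousAt.eventually_lt (by fun_prop) (by fun_prop) (by simpa))
        filter_upwards [h1.filter_mono nhdsWithin_le_nhds, eventually_mem_nhdsWithin]
          with h h2 h3 y hy
        rw [dist_comm, dist_eq_norm]
        exact (norm_div_sub_deriv_le ((ix y hy).mono hεU) (fun x' hx' => hM x' hx' y hy)
          h2.1 h3).trans_lt h2.2
      refine key.tendstoLocallyUniformlyOn.differentiableOn ?_ hV
      have h1 : ∀ᶠ h in 𝓝 (0 : ℂ), ‖h‖ < ε :=
        ContinuousAt.eventually_lt (by fun_prop) (by fun_prop) (by simpa)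
      filter_upwards [h1.filter_mono nhdsWithin_le_nhds] with h hh
      exact ((iy _ (hεU (by simpa))).sub (iy _ hx)).div_const h
    · obtain ⟨ε, hε, M, hεU, hM⟩ := ib x hx
      refine ⟨ε / 2, by positivity, M / (ε / 2), (ball_subset_ball (by linarith)).trans hεU,
        fun x' hx' y hy => ?_⟩
      have hsub : closedBall x' (ε / 2) ⊆ ball x ε := by
        intro z hz
        rw [mem_closedBall] at hz
        rw [mem_ball] at hx' ⊢
        linarith [dist_triangle z x' x]
      refine Complex.norm_deriv_le_of_forall_mem_sphere_norm_le (by positivity) ?_ ?_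
      · exact (((ix y hy).mono hεU).mono hsub).diffContOnCl_ball subset_rfl
      · intro z hz
        exact hM z (hsub (sphere_subset_closedBall hz)) y hy

open MeasureTheory Real in
/-- The sub-mean value inequality for the logarithm of the norm of an analytic function. -/
theorem log_norm_le_circleAverage {f : ℂ → ℂ} {c : ℂ} {s : ℝ} (hs : 0 < s)
    (hf : AnalyticOnNhd ℂ f (closedBall c s)) (h0 : f c ≠ 0) :
    log ‖f c‖ ≤ circleAverage (log ‖f ·‖) c s := by
  have hf' : AnalyticOnNhd ℂ f (closedBall c |s|) := by rwa [abs_of_pos hs]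
  rw [hf'.circleAverage_log_norm hs.ne' h0, le_add_iff_nonneg_left]
  refine finsum_nonneg fun u => ?_
  by_cases hu : u ∈ closedBall c |s|
  · refine mul_nonneg ?_ ?_
    · exact_mod_cast MeromorphicOn.AnalyticOnNhd.divisor_nonneg hf' u
    · rcases eq_or_ne c u with rfl | hne
      · simp
      · apply log_nonneg
        rw [← div_eq_mul_inv, one_le_div (by simpa [sub_eq_zero] using hne), ← dist_eq_norm,
          dist_comm]
        rwa [abs_of_pos hs] at hu
  · simp [hu]

open MeasureTheory Real in
theorem ofReal_log_norm_le_lintegral {f : ℂ → ℂ} {c : ℂ} {s : ℝ} (hs : 0 < s)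
    (hf : AnalyticOnNhd ℂ f (closedBall c s)) (h0 : f c ≠ 0) :
    ENNReal.ofReal (2 * π * log ‖f c‖) ≤
      ∫⁻ θ in Ioo (-π) π, ENNReal.ofReal (log ‖f (circleMap c s θ)‖) := by
  have h1 := log_norm_le_circleAverage hs hf h0
  have hI : CircleIntegrable (log ‖f ·‖) c s := by
    refine MeromorphicOn.circleIntegrable_log_norm fun z hz => ?_
    rw [abs_of_pos hs] at hz
    exact (hf z (sphere_subset_closedBall hz)).meromorphicAt
  have hper : Function.Periodic (fun θ => log ‖f (circleMap c s θ)‖) (2 * π) :=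
    fun x => by simp [periodic_circleMap c s x]
  have h2 := hper.intervalIntegral_add_eq 0 (-π)
  have hI' : IntervalIntegrable (fun θ => log ‖f (circleMap c s θ)‖) volume (-π) π :=
    hper.intervalIntegrable₀ two_pi_pos.ne' hI _ _
  rw [zero_add, show -π + 2 * π = π by ring] at h2
  rw [circleAverage, h2, intervalIntegral.integral_of_le (by linarith [pi_pos]),
    integral_Ioc_eq_integral_Ioo, smul_eq_mul, ← div_eq_inv_mul, le_div_iff₀ two_pi_pos,
    mul_comm] at h1
  have hI : IntegrableOn (fun θ => log ‖f (circleMap c s θ)‖) (Ioo (-π) π) := by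
    rw [intervalIntegrable_iff_integrableOn_Ioo_of_le (by linarith [pi_pos])] at hI'
    exact hI'
  refine (ENNReal.ofReal_le_ofReal h1).trans ?_
  rw [integral_eq_lintegral_pos_part_sub_lintegral_neg_part hI]
  refine (ENNReal.ofReal_le_ofReal (sub_le_self _ ENNReal.toReal_nonneg)).trans ?_
  exact ENNReal.ofReal_toReal_le

open MeasureTheory Real in
/-- If a holomorphic function on a disc is bounded by `exp β`, and by `1` away from a set `O`, then
its value at the centre is controlled by the area of `O`. -/
theorem ofReal_log_norm_mul_le {f : ℂ → ℂ} {c : ℂ} {R β : ℝ} {O : Set ℂ} (hβ : 0 ≤ β)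
    (hR : 0 < R) (hO : MeasurableSet O) (hf : DifferentiableOn ℂ f (ball c R))
    (h1 : ∀ z ∈ ball c R, ‖f z‖ ≤ exp β) (h2 : ∀ z ∈ ball c R, z ∉ O → ‖f z‖ ≤ 1)
    (h0 : f c ≠ 0) :
    ENNReal.ofReal (π * R ^ 2 * log ‖f c‖) ≤ ENNReal.ofReal β * volume O := by
  set χ : ℂ → ENNReal := fun z => O.indicator 1 (c + z) with hχ
  have hχm : Measurable χ := (measurable_one.indicator hO).comp (measurable_const_add c)
  have hcirc : ∀ s ∈ Ioo 0 R, ENNReal.ofReal (2 * π * log ‖f c‖) ≤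
      ENNReal.ofReal β * ∫⁻ θ in Ioo (-π) π, χ (Complex.polarCoord.symm (s, θ)) := by
    intro s hs
    have hsub : closedBall c s ⊆ ball c R := closedBall_subset_ball hs.2
    refine (ofReal_log_norm_le_lintegral hs.1
      ((hf.analyticOnNhd isOpen_ball).mono hsub) h0).trans ?_
    rw [← lintegral_const_mul' _ _ ENNReal.ofReal_ne_top]
    refine lintegral_mono fun θ => ?_
    have hmem : circleMap c s θ ∈ ball c R := hsub (circleMap_mem_closedBall c hs.1.le θ)
    have heq : c + Complex.polarCoord.symm (s, θ) = circleMap c s θ := by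
      simp [Complex.polarCoord_symm_apply, circleMap, Complex.exp_mul_I]
    simp only [hχ, heq]
    by_cases hz : circleMap c s θ ∈ O
    · simp only [indicator_of_mem hz, Pi.one_apply, mul_one]
      refine ENNReal.ofReal_le_ofReal ?_
      rcases eq_or_ne (f (circleMap c s θ)) 0 with h | h
      · simpa [h] using hβ
      · exact (log_le_iff_le_exp (norm_pos_iff.2 h)).2 (h1 _ hmem)
    · simp only [indicator_of_notMem hz, mul_zero, nonpos_iff_eq_zero, ENNReal.ofReal_eq_zero]
      exact log_nonpos (norm_nonneg _) (h2 _ hmem hz)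
  have hvol : ∫⁻ z, χ z = volume O := by
    rw [hχ, lintegral_add_left_eq_self (fun z => O.indicator (1 : ℂ → ENNReal) z) c,
      lintegral_indicator_one hO]
  have hpolar : ∫⁻ s in Ioi (0 : ℝ), ENNReal.ofReal s *
      ∫⁻ θ in Ioo (-π) π, χ (Complex.polarCoord.symm (s, θ)) = volume O := by
    rw [← hvol, ← Complex.lintegral_comp_polarCoord_symm, polarCoord_target,
      Measure.volume_eq_prod, setLIntegral_prod]
    · refine lintegral_congr fun s => ?_
      simp only [smul_eq_mul]
      rw [lintegral_const_mul' _ _ ENNReal.ofReal_ne_top]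
    · simp only [smul_eq_mul]
      refine Measurable.aemeasurable ?_
      refine (ENNReal.measurable_ofReal.comp measurable_fst).mul (hχm.comp ?_)
      have : Continuous fun p : ℝ × ℝ => Complex.polarCoord.symm p := by
        simp only [Complex.polarCoord_symm_apply]
        fun_prop
      exact this.measurable
  have hI : ∫⁻ s in Ioo 0 R, ENNReal.ofReal s = ENNReal.ofReal (R ^ 2 / 2) := by
    rw [← ofReal_integral_eq_lintegral_ofReal]
    · rw [← integral_Ioc_eq_integral_Ioo, ← intervalIntegral.integral_of_le hR.le, integral_id]
      simp
    · exact (continuous_id.integrableOn_Icc (a := 0) (b := R)).mono_set Ioo_subset_Icc_self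
    · filter_upwards [ae_restrict_mem measurableSet_Ioo] with s hs using hs.1.le
  calc ENNReal.ofReal (π * R ^ 2 * log ‖f c‖)
      = (∫⁻ s in Ioo 0 R, ENNReal.ofReal s) * ENNReal.ofReal (2 * π * log ‖f c‖) := by
        rw [hI, ← ENNReal.ofReal_mul (by positivity)]
        ring_nf
    _ = ∫⁻ s in Ioo 0 R, ENNReal.ofReal s * ENNReal.ofReal (2 * π * log ‖f c‖) :=
        (lintegral_mul_const' _ _ ENNReal.ofReal_ne_top).symm
    _ ≤ ∫⁻ s in Ioo 0 R, ENNReal.ofReal β * (ENNReal.ofReal s *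
          ∫⁻ θ in Ioo (-π) π, χ (Complex.polarCoord.symm (s, θ))) := by
        refine setLIntegral_mono' measurableSet_Ioo fun s hs => ?_
        rw [mul_left_comm]
        gcongr
        exact hcirc s hs
    _ ≤ ∫⁻ s in Ioi 0, ENNReal.ofReal β * (ENNReal.ofReal s *
          ∫⁻ θ in Ioo (-π) π, χ (Complex.polarCoord.symm (s, θ))) :=
        lintegral_mono_set Ioo_subset_Ioi_self
    _ = ENNReal.ofReal β * volume O := by
        rw [lintegral_const_mul' _ _ ENNReal.ofReal_ne_top, hpolar]

/-- A Hartogs type estimate: geometric bounds which hold away from a set of small area propagate to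
a smaller disc. -/
theorem norm_le_mul_two_mul_pow {h : ℂ → ℂ} {y₀ : ℂ} {r A B C : ℝ} {O : Set ℂ} {j : ℕ}
    (hC : 0 < C) (hB : 0 < B) (hBA : B ≤ A) (hO : MeasurableSet O)
    (hh : DifferentiableOn ℂ h (ball y₀ r)) (hA : ∀ y ∈ ball y₀ r, ‖h y‖ ≤ C * A ^ j)
    (hBO : ∀ y ∈ ball y₀ r, y ∉ O → ‖h y‖ ≤ C * B ^ j)
    (hvol : ENNReal.ofReal (Real.log (A / B)) * MeasureTheory.volume O ≤
      ENNReal.ofReal (Real.pi * (r / 2) ^ 2 * Real.log 2)) :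
    ∀ y ∈ ball y₀ (r / 2), ‖h y‖ ≤ C * (2 * B) ^ j := by
  intro y hy
  have hr : 0 < r / 2 := pos_of_mem_ball hy
  rcases eq_or_ne (h y) 0 with h0 | h0
  · rw [h0, norm_zero]; positivity
  have hA0 : 0 < A := hB.trans_le hBA
  have hsub : ball y (r / 2) ⊆ ball y₀ r := by
    refine ball_subset_ball' ?_
    rw [mem_ball] at hy
    linarith
  have hCB : 0 < C * B ^ j := by positivity
  have hlog : 0 ≤ Real.log (A / B) := Real.log_nonneg ((one_le_div hB).2 hBA)
  have hnorm : ∀ z, ‖h z / ((C * B ^ j : ℝ) : ℂ)‖ = ‖h z‖ / (C * B ^ j) := by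
    intro z
    rw [norm_div, Complex.norm_real, Real.norm_of_nonneg hCB.le]
  have key := ofReal_log_norm_mul_le (f := fun z => h z / ((C * B ^ j : ℝ) : ℂ)) (c := y)
    (R := r / 2) (β := j * Real.log (A / B)) (O := O) (by positivity) hr hO
    ((hh.mono hsub).div_const _) (fun z hz => ?_) (fun z hz hzO => ?_)
    (div_ne_zero h0 (by exact_mod_cast hCB.ne'))
  · rw [ENNReal.ofReal_mul (Nat.cast_nonneg j), mul_assoc (ENNReal.ofReal j)] at key
    have key2 := key.trans (mul_le_mul_right hvol (ENNReal.ofReal j))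
    rw [← ENNReal.ofReal_mul (Nat.cast_nonneg j), ENNReal.ofReal_le_ofReal_iff (by positivity),
      hnorm] at key2
    have hpos : 0 < Real.pi * (r / 2) ^ 2 := by positivity
    have key3 : Real.log (‖h y‖ / (C * B ^ j)) ≤ j * Real.log 2 := by
      refine le_of_mul_le_mul_left ?_ hpos
      linarith
    rw [← Real.log_pow, Real.log_le_log_iff (by positivity) (by positivity),
      div_le_iff₀ hCB] at key3
    rw [mul_pow]
    linarith
  · rw [hnorm, div_le_iff₀ hCB, ← Real.log_pow, Real.exp_log (by positivity), div_pow]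
    refine (hA z (hsub hz)).trans_eq ?_
    field_simp
  · rw [hnorm, div_le_one hCB]
    exact hBO z (hsub hz) hzO

namespace Projectivization

variable {m : ℕ}

/-- The `l`-th affine coordinate of a point of projective space in the `i`-th standard chart. -/
noncomputable def affineCoord (i l : Fin (m + 1)) (p : Projectivization ℂ (Fin (m + 1) → ℂ)) : ℂ :=
  p.rep l / p.rep i

/-- A point of projective space lies in the closed polydisc of radius `K` of the `i`-th standard
chart. -/
def InPolydisc (i : Fin (m + 1)) (K : ℝ) (p : Projectivization ℂ (Fin (m + 1) → ℂ)) : Prop :=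
  ∀ l, ‖p.rep l‖ ≤ K * ‖p.rep i‖

/-- A point of projective space lies in the open polydisc of radius `K` of the `i`-th standard
chart. -/
def InOpenPolydisc (i : Fin (m + 1)) (K : ℝ) (p : Projectivization ℂ (Fin (m + 1) → ℂ)) : Prop :=
  ∀ l, ‖p.rep l‖ < K * ‖p.rep i‖

variable {i : Fin (m + 1)} {K : ℝ}

theorem exists_rep_mk_eq {v : Fin (m + 1) → ℂ} (hv : v ≠ 0) :
    ∃ a : ℂ, a ≠ 0 ∧ (mk ℂ v hv).rep = a • v := by
  obtain ⟨a, ha⟩ := exists_smul_eq_mk_rep ℂ v hv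
  exact ⟨a, a.ne_zero, ha.symm⟩

theorem rep_mk_apply_ne_zero_iff {v : Fin (m + 1) → ℂ} (hv : v ≠ 0) :
    (mk ℂ v hv).rep i ≠ 0 ↔ v i ≠ 0 := by
  obtain ⟨a, ha, h⟩ := exists_rep_mk_eq hv
  simp [h, ha]

theorem affineCoord_mk {v : Fin (m + 1) → ℂ} (hv : v ≠ 0) (l : Fin (m + 1)) :
    affineCoord i l (mk ℂ v hv) = v l / v i := by
  obtain ⟨a, ha, h⟩ := exists_rep_mk_eq hv
  simp [affineCoord, h, mul_div_mul_left _ _ ha]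

theorem inPolydisc_mk {v : Fin (m + 1) → ℂ} (hv : v ≠ 0) :
    InPolydisc i K (mk ℂ v hv) ↔ ∀ l, ‖v l‖ ≤ K * ‖v i‖ := by
  obtain ⟨a, ha, h⟩ := exists_rep_mk_eq hv
  refine forall_congr' fun l => ?_
  rw [h, Pi.smul_apply, Pi.smul_apply, smul_eq_mul, smul_eq_mul, norm_mul, norm_mul,
    mul_left_comm, mul_le_mul_iff_right₀ (norm_pos_iff.2 ha)]

theorem inOpenPolydisc_mk {v : Fin (m + 1) → ℂ} (hv : v ≠ 0) :
    InOpenPolydisc i K (mk ℂ v hv) ↔ ∀ l, ‖v l‖ < K * ‖v i‖ := by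
  obtain ⟨a, ha, h⟩ := exists_rep_mk_eq hv
  refine forall_congr' fun l => ?_
  rw [h, Pi.smul_apply, Pi.smul_apply, smul_eq_mul, smul_eq_mul, norm_mul, norm_mul,
    mul_left_comm, mul_lt_mul_iff_right₀ (norm_pos_iff.2 ha)]

variable {p : Projectivization ℂ (Fin (m + 1) → ℂ)}

theorem InOpenPolydisc.inPolydisc (h : InOpenPolydisc i K p) : InPolydisc i K p :=
  fun l => (h l).le

theorem InPolydisc.rep_ne_zero (h : InPolydisc i K p) : p.rep i ≠ 0 := by
  intro h0
  refine p.rep_nonzero (funext fun l => ?_)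
  simpa [h0] using h l

theorem InPolydisc.norm_affineCoord_le (h : InPolydisc i K p) (l : Fin (m + 1)) :
    ‖affineCoord i l p‖ ≤ K := by
  rw [affineCoord, norm_div, div_le_iff₀ (norm_pos_iff.2 h.rep_ne_zero)]
  exact h l

theorem exists_inOpenPolydisc (p : Projectivization ℂ (Fin (m + 1) → ℂ)) :
    ∃ i K, 0 < K ∧ InOpenPolydisc i K p := by
  obtain ⟨i, hi⟩ := Function.ne_iff.1 p.rep_nonzero
  have hi' : 0 < ‖p.rep i‖ := norm_pos_iff.2 hi
  refine ⟨i, (‖p.rep‖ + 1) / ‖p.rep i‖, by positivity, fun l => ?_⟩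
  rw [div_mul_cancel₀ _ hi'.ne']
  linarith [norm_le_pi_norm p.rep l]

theorem eq_mk_affineCoord (h : p.rep i ≠ 0) :
    ∃ h0 : (fun l => affineCoord i l p) ≠ 0, p = mk ℂ (fun l => affineCoord i l p) h0 := by
  have h0 : (fun l => affineCoord i l p) ≠ 0 := by
    intro h1
    have := congrFun h1 i
    simp [affineCoord, h] at this
  refine ⟨h0, ?_⟩
  conv_lhs => rw [← p.mk_rep]
  rw [mk_eq_mk_iff']
  refine ⟨p.rep i, funext fun l => ?_⟩
  simp [affineCoord, mul_div_cancel₀ _ h]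

end Projectivization

open Projectivization

/-- A map to projective space is holomorphic near a point if it has a holomorphic lift there. -/
def HolomorphicAtP {E : Type*} [NormedAddCommGroup E] [NormedSpace ℂ E] {m : ℕ}
    (f : E → Projectivization ℂ (Fin (m + 1) → ℂ)) (z : E) : Prop :=
  ∃ F : E → Fin (m + 1) → ℂ, ∀ᶠ w in 𝓝 z,
    DifferentiableAt ℂ F w ∧ ∃ h : F w ≠ 0, f w = Projectivization.mk ℂ (F w) h

namespace HolomorphicAtP

variable {E : Type*} [NormedAddCommGroup E] [NormedSpace ℂ E] {m : ℕ}
  {f : E → Projectivization ℂ (Fin (m + 1) → ℂ)} {z : E} {i : Fin (m + 1)} {K : ℝ}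

theorem eventually_inOpenPolydisc (hf : HolomorphicAtP f z) (h : InOpenPolydisc i K (f z)) :
    ∀ᶠ w in 𝓝 z, InOpenPolydisc i K (f w) := by
  obtain ⟨F, hF⟩ := hf
  obtain ⟨hd, h0, hz⟩ := hF.self_of_nhds
  rw [hz, inOpenPolydisc_mk] at h
  have hc : ∀ l, ContinuousAt (fun w => F w l) z := fun l =>
    (continuous_apply l).continuousAt.comp hd.continuousAt
  have : ∀ᶠ w in 𝓝 z, ∀ l, ‖F w l‖ < K * ‖F w i‖ := by
    rw [eventually_all]
    exact fun l => (hc l).norm.eventually_lt (continuousAt_const.mul (hc i).norm) (h l)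
  filter_upwards [hF, this] with w hw h1
  obtain ⟨-, h0, hw⟩ := hw
  rwa [hw, inOpenPolydisc_mk]

theorem inPolydisc_of_frequently (hf : HolomorphicAtP f z)
    (h : ∃ᶠ w in 𝓝 z, InPolydisc i K (f w)) : InPolydisc i K (f z) := by
  obtain ⟨F, hF⟩ := hf
  obtain ⟨hd, h0, hz⟩ := hF.self_of_nhds
  have hc : ∀ l, ContinuousAt (fun w => F w l) z := fun l =>
    (continuous_apply l).continuousAt.comp hd.continuousAt
  by_contra h1
  rw [hz, inPolydisc_mk] at h1
  push Not at h1
  obtain ⟨l, hl⟩ := h1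
  refine h ?_
  filter_upwards [hF, (continuousAt_const.mul (hc i).norm).eventually_lt (hc l).norm hl]
    with w hw h2 h3
  obtain ⟨-, h0, hw⟩ := hw
  rw [hw, inPolydisc_mk] at h3
  exact h2.not_ge (h3 l)

theorem eventually_rep_ne_zero (hf : HolomorphicAtP f z) (h : (f z).rep i ≠ 0) :
    ∀ᶠ w in 𝓝 z, (f w).rep i ≠ 0 := by
  obtain ⟨F, hF⟩ := hf
  obtain ⟨hd, h0, hz⟩ := hF.self_of_nhds
  rw [hz, rep_mk_apply_ne_zero_iff] at h
  have hc : ContinuousAt (fun w => F w i) z :=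
    (continuous_apply i).continuousAt.comp hd.continuousAt
  filter_upwards [hF, hc.eventually_ne h] with w hw h1
  obtain ⟨-, h0, hw⟩ := hw
  rwa [hw, rep_mk_apply_ne_zero_iff]

theorem differentiableAt_affineCoord (hf : HolomorphicAtP f z) (h : (f z).rep i ≠ 0)
    (l : Fin (m + 1)) : DifferentiableAt ℂ (fun w => affineCoord i l (f w)) z := by
  obtain ⟨F, hF⟩ := hf
  obtain ⟨hd, h0, hz⟩ := hF.self_of_nhds
  rw [hz, rep_mk_apply_ne_zero_iff] at h
  rw [differentiableAt_pi] at hd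
  refine ((hd l).fun_mul ((hd i).fun_inv h)).congr_of_eventuallyEq ?_
  filter_upwards [hF] with w hw
  obtain ⟨-, h0, hw⟩ := hw
  rw [hw, affineCoord_mk, div_eq_mul_inv]

theorem of_affineCoord (h : ∀ᶠ w in 𝓝 z, (f w).rep i ≠ 0 ∧
    ∀ l, DifferentiableAt ℂ (fun w => affineCoord i l (f w)) w) : HolomorphicAtP f z := by
  refine ⟨fun w l => affineCoord i l (f w), ?_⟩
  filter_upwards [h] with w hw
  exact ⟨differentiableAt_pi.2 hw.2, eq_mk_affineCoord hw.1⟩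

theorem comp {G : Type*} [NormedAddCommGroup G] [NormedSpace ℂ G] {g : G → E} {x : G}
    (hf : HolomorphicAtP f (g x)) (hg : Differentiable ℂ g) :
    HolomorphicAtP (fun y => f (g y)) x := by
  obtain ⟨F, hF⟩ := hf
  refine ⟨fun y => F (g y), ?_⟩
  filter_upwards [hg.continuous.continuousAt.eventually hF] with y hy
  exact ⟨hy.1.comp y (hg y), hy.2⟩

/-- If the Taylor coefficients of the affine coordinates of a holomorphic map from a disc to
projective space satisfy Cauchy bounds, then the map stays in the affine chart. -/
theorem rep_ne_zero_of_norm_iteratedDeriv_le {f : ℂ → Projectivization ℂ (Fin (m + 1) → ℂ)}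
    {a : ℂ} {R C : ℝ} (hf : ∀ x ∈ ball a R, HolomorphicAtP f x) (ha : (f a).rep i ≠ 0)
    (hC : ∀ l n, ‖iteratedDeriv n (fun x => affineCoord i l (f x)) a‖ ≤ n.factorial * C / R ^ n) :
    ∀ x ∈ ball a R, (f x).rep i ≠ 0 ∧ ∀ l, ‖affineCoord i l (f x)‖ ≤ C * (1 - ‖x - a‖ / R)⁻¹ := by
  intro x₁ hx₁
  have hR : 0 < R := pos_of_mem_ball hx₁
  set t : Fin (m + 1) → ℕ → ℂ → ℂ := fun l n x => (n.factorial : ℂ)⁻¹ • (x - a) ^ n •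
    iteratedDeriv n (fun x => affineCoord i l (f x)) a with ht
  have hC0 : 0 ≤ C := by
    have := (norm_nonneg _).trans (hC i 0)
    simpa using this
  have htn : ∀ l n x, ‖t l n x‖ ≤ C * (‖x - a‖ / R) ^ n := by
    intro l n x
    have h1 : (0 : ℝ) < n.factorial := by positivity
    simp only [ht, norm_smul, norm_inv, norm_pow, Complex.norm_natCast]
    calc (n.factorial : ℝ)⁻¹ * (‖x - a‖ ^ n *
          ‖iteratedDeriv n (fun x => affineCoord i l (f x)) a‖)
        ≤ (n.factorial : ℝ)⁻¹ * (‖x - a‖ ^ n * (n.factorial * C / R ^ n)) := by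
          gcongr
          exact hC l n
      _ = _ := by rw [div_pow]; field_simp
  have hlt : ∀ {x}, x ∈ ball a R → ‖x - a‖ / R < 1 := by
    intro x hx
    rw [div_lt_one hR]
    simpa [dist_eq_norm] using hx
  have hG : ∀ l, DifferentiableOn ℂ (fun x => ∑' n, t l n x) (ball a R) := by
    intro l x hx
    obtain ⟨R', h1, h2⟩ := exists_between (mem_ball.1 hx)
    have hR' : 0 < R' := dist_nonneg.trans_lt h1
    have hlt' : R' / R < 1 := (div_lt_one hR).2 h2
    have hs : Summable fun n : ℕ => C * (R' / R) ^ n :=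
      (summable_geometric_of_lt_one (by positivity) hlt').mul_left C
    refine ((Complex.differentiableOn_tsum_of_summable_norm hs (F := t l) (U := ball a R')
      (fun n => ?_) isOpen_ball fun n w hw => ?_).differentiableAt
      (isOpen_ball.mem_nhds h1)).differentiableWithinAt
    · exact Differentiable.differentiableOn (by fun_prop)
    · refine (htn l n w).trans ?_
      rw [mem_ball, dist_eq_norm] at hw
      gcongr
  have main : ball a R ⊆ {x | ∀ᶠ w in 𝓝 x, (f w).rep i ≠ 0 ∧
      ∀ l, affineCoord i l (f w) = ∑' n, t l n w} := by
    refine (convex_ball a R).isPreconnected.subset_of_closure_inter_subset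
      isOpen_setOfPred_eventually_nhds ⟨a, mem_ball_self hR, ?_⟩ ?_
    · have h1 := (hf a (mem_ball_self hR)).eventually_rep_ne_zero ha
      have h2 := h1.and (isOpen_ball.mem_nhds (mem_ball_self hR))
      obtain ⟨δ, hδ, hδs⟩ := Metric.eventually_nhds_iff_ball.1 h2
      rw [mem_ofPred_eq, Metric.eventually_nhds_iff_ball]
      refine ⟨δ, hδ, fun x hx => ⟨(hδs x hx).1, fun l => ?_⟩⟩
      have hd : DifferentiableOn ℂ (fun x => affineCoord i l (f x)) (ball a δ) := fun y hy =>
        ((hf y (hδs y hy).2).differentiableAt_affineCoord (hδs y hy).1 l).differentiableWithinAt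
      exact (Complex.hasSum_taylorSeries_on_ball hd hx).tsum_eq.symm
    · rintro x ⟨hxc, hx⟩
      by_contra hxn
      obtain ⟨F, hF⟩ := hf x hx
      have hFan : ∀ l, AnalyticAt ℂ (fun w => F w l) x := fun l => by
        rw [Complex.analyticAt_iff_eventually_differentiableAt]
        filter_upwards [hF] with w hw using differentiableAt_pi.1 hw.1 l
      have hGan : ∀ l, AnalyticAt ℂ (fun x => ∑' n, t l n x) x := fun l =>
        (hG l).analyticAt (isOpen_ball.mem_nhds hx)
      have hfreq := mem_closure_iff_frequently.1 hxc
      have key : ∀ l, ∀ᶠ w in 𝓝 x, F w l - F w i * ∑' n, t l n w = 0 := by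
        intro l
        refine ((hFan l).sub ((hFan i).mul (hGan l))).frequently_zero_iff_eventually_zero.1 ?_
        rw [frequently_nhdsWithin_iff]
        refine (hfreq.and_eventually hF).mono fun w hw => ⟨?_, ?_⟩
        · obtain ⟨hwu, -, h0, hw⟩ := hw
          obtain ⟨h1, h2⟩ := hwu.self_of_nhds
          have h3 := h2 l
          rw [hw, rep_mk_apply_ne_zero_iff] at h1
          rw [hw, affineCoord_mk, div_eq_iff h1] at h3
          change F w l - F w i * ∑' n, t l n w = 0
          rw [h3]
          ring
        · rintro rfl
          exact hxn hw.1
      refine hxn ?_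
      filter_upwards [hF, eventually_all.2 key] with w hw hk
      obtain ⟨-, h0, hw⟩ := hw
      have hi : F w i ≠ 0 := by
        intro hi
        refine h0 (funext fun l => ?_)
        have := hk l
        rw [hi] at this
        simpa using this
      rw [hw, rep_mk_apply_ne_zero_iff]
      refine ⟨hi, fun l => ?_⟩
      rw [affineCoord_mk, div_eq_iff hi]
      linear_combination hk l
  obtain ⟨h1, h2⟩ := (main hx₁).self_of_nhds
  refine ⟨h1, fun l => ?_⟩
  rw [h2 l]
  exact tsum_of_norm_bounded ((hasSum_geometric_of_lt_one (by positivity) (hlt hx₁)).mul_left C)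
    fun n => htn l n x₁

end HolomorphicAtP

theorem Complex.norm_iteratedDeriv_le_of_forall_mem_ball_norm_le {g : ℂ → ℂ} {a : ℂ} {s K : ℝ}
    (hs : 0 < s) (hg : DifferentiableOn ℂ g (ball a s)) (hK : ∀ x ∈ ball a s, ‖g x‖ ≤ K) (n : ℕ) :
    ‖iteratedDeriv n g a‖ ≤ n.factorial * K * (2 / s) ^ n := by
  have hsub : closedBall a (s / 2) ⊆ ball a s := closedBall_subset_ball (by linarith)
  refine (Complex.norm_iteratedDeriv_le_of_forall_mem_sphere_norm_le n (half_pos hs)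
    (hg.diffContOnCl_ball hsub) fun z hz => hK z (hsub (sphere_subset_closedBall hz))).trans_eq ?_
  rw [div_eq_mul_inv, ← inv_pow, inv_div]

namespace HolomorphicAtP

variable {E : Type*} [NormedAddCommGroup E] {m : ℕ} {i : Fin (m + 1)} {K : ℝ}

/-- The Hartogs estimate: a separately holomorphic map which stays in a polydisc of an affine chart
on a thin cylinder, and on a thick cylinder away from a set of small area, stays in the chart on a
bidisc whose size does not depend on the thin cylinder. -/
theorem rep_ne_zero_of_inPolydisc {f : ℂ → ℂ → Projectivization ℂ (Fin (m + 1) → ℂ)}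
    {x₀ y₀ a : ℂ} {r ρ : ℝ} {O : Set ℂ} (hK : 0 < K) (hρ : 0 < ρ) (hρr : ρ ≤ r / 2)
    (ha : a ∈ ball x₀ (r / 8))
    (hx : ∀ y ∈ ball y₀ r, ∀ x ∈ ball x₀ r, HolomorphicAtP (f · y) x)
    (hy : ∀ x ∈ ball x₀ r, ∀ y ∈ ball y₀ r, HolomorphicAtP (f x) y)
    (hA : ∀ x ∈ ball a ρ, ∀ y ∈ ball y₀ r, InPolydisc i K (f x y))
    (hO : MeasurableSet O)
    (hB : ∀ y ∈ ball y₀ r, y ∉ O → ∀ x ∈ ball x₀ r, InPolydisc i K (f x y))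
    (hvol : ENNReal.ofReal (Real.log (2 / ρ / (2 / r))) * MeasureTheory.volume O ≤
      ENNReal.ofReal (Real.pi * (r / 2) ^ 2 * Real.log 2)) :
    ∀ x ∈ ball x₀ (r / 16), ∀ y ∈ ball y₀ (r / 2),
      (f x y).rep i ≠ 0 ∧ ∀ l, ‖affineCoord i l (f x y)‖ ≤ 4 * K := by
  intro x hxm y hym
  have hr : 0 < r := by linarith
  rw [mem_ball] at ha hxm
  have hsub : ∀ {s}, s ≤ r / 2 → ball a s ⊆ ball x₀ r := fun hs =>
    ball_subset_ball' (by linarith)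
  have hyr : ball y₀ (r / 2) ⊆ ball y₀ r := ball_subset_ball (by linarith)
  have haρ : a ∈ ball a ρ := mem_ball_self hρ
  have hd : ∀ l, ∀ x ∈ ball a ρ, ∀ y ∈ ball y₀ r,
      DifferentiableAt ℂ (fun y => affineCoord i l (f x y)) y := fun l x hx y hym =>
    (hy x (hsub hρr hx) y hym).differentiableAt_affineCoord (hA x hx y hym).rep_ne_zero l
  have hd' : ∀ l, ∀ y ∈ ball y₀ r, ∀ x ∈ ball a ρ,
      DifferentiableAt ℂ (fun x => affineCoord i l (f x y)) x := fun l y hym x hxm =>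
    (hx y hym x (hsub hρr hxm)).differentiableAt_affineCoord (hA x hxm y hym).rep_ne_zero l
  have hest : ∀ l n, ‖iteratedDeriv n (fun x => affineCoord i l (f x y)) a‖ ≤
      n.factorial * K * (2 * (2 / r)) ^ n := by
    intro l n
    have hsep := (separately_iteratedDeriv (φ := fun x y => affineCoord i l (f x y))
      (U := ball a ρ) isOpen_ball
      (fun y hym x hxm => (hd' l y hym x hxm).differentiableWithinAt)
      (fun x hxm y hym => (hd l x hxm y hym).differentiableWithinAt)
      (fun x hxm => by
        obtain ⟨ε, hε, h⟩ := Metric.isOpen_iff.1 isOpen_ball x hxm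
        exact ⟨ε, hε, K, h, fun x' hx' y hym => (hA x' (h hx') y hym).norm_affineCoord_le l⟩)
      n).2.1 a haρ
    refine norm_le_mul_two_mul_pow (O := O) (A := 2 / ρ) (by positivity) (by positivity) ?_ hO hsep
      (fun y hym => ?_) (fun y hym hyO => ?_) hvol y hym
    · gcongr
      linarith
    · exact Complex.norm_iteratedDeriv_le_of_forall_mem_ball_norm_le hρ
        (fun x hxm => (hd' l y hym x hxm).differentiableWithinAt)
        (fun x hxm => (hA x hxm y hym).norm_affineCoord_le l) n
    · have hr2 : 0 < r / 2 := by linarith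
      have hsub' : closedBall a (r / 2) ⊆ ball x₀ r := closedBall_subset_ball' (by linarith)
      have hin := fun x hxm => hB y hym hyO x (hsub' hxm)
      have hdc : DifferentiableOn ℂ (fun x => affineCoord i l (f x y)) (closedBall a (r / 2)) :=
        fun x hxm => ((hx y hym x (hsub' hxm)).differentiableAt_affineCoord
          (hin x hxm).rep_ne_zero l).differentiableWithinAt
      refine (Complex.norm_iteratedDeriv_le_of_forall_mem_sphere_norm_le n hr2
        (hdc.diffContOnCl_ball subset_rfl) fun z hz =>
          (hin z (sphere_subset_closedBall hz)).norm_affineCoord_le l).trans_eq ?_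
      rw [div_eq_mul_inv, ← inv_pow, inv_div]
  have hxa : dist x a < 3 * r / 16 := by
    have := dist_triangle_right x a x₀
    linarith
  obtain ⟨h1, h2⟩ := rep_ne_zero_of_norm_iteratedDeriv_le (f := fun x => f x y) (R := r / 4) (C := K)
    (fun x hxm => hx y (hyr hym) x (hsub (by linarith) hxm)) (hA a haρ y (hyr hym)).rep_ne_zero
    (fun l n => by
      refine (hest l n).trans_eq ?_
      rw [div_eq_mul_inv (_ * K), ← inv_pow, inv_div, ← mul_div_assoc]
      norm_num) x (by rw [mem_ball]; linarith)
  refine ⟨h1, fun l => (h2 l).trans ?_⟩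
  rw [mul_comm]
  gcongr
  rw [← dist_eq_norm]
  have h3 : dist x a / (r / 4) ≤ 3 / 4 := by
    rw [div_le_iff₀ (by linarith)]
    linarith
  rw [inv_le_comm₀ (by linarith) (by norm_num)]
  linarith

/-- The points over which a map to projective space stays in a polydisc of an affine chart on a
cylinder of fixed thickness. -/
def chartSet (f : ℂ → ℂ → E → Projectivization ℂ (Fin (m + 1) → ℂ)) (i : Fin (m + 1)) (K : ℝ)
    (x₀ y₀ : ℂ) (c₀ : E) (r : ℝ) (k : ℕ) : Set ℂ :=
  {x | x ∈ closedBall x₀ r ∧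
    ∀ y ∈ closedBall y₀ r, ∀ c ∈ ball c₀ (r / (k + 1)), InPolydisc i K (f x y c)}

variable {f : ℂ → ℂ → E → Projectivization ℂ (Fin (m + 1) → ℂ)} {x₀ y₀ : ℂ} {c₀ : E} {r : ℝ}

theorem monotone_chartSet (hr : 0 ≤ r) : Monotone (chartSet f i K x₀ y₀ c₀ r) := by
  intro k k' hk x hx
  refine ⟨hx.1, fun y hy c hc => hx.2 y hy c (ball_subset_ball ?_ hc)⟩
  gcongr

theorem isClosed_chartSet (hr : 0 ≤ r)
    (hx : ∀ y ∈ closedBall y₀ r, ∀ c ∈ ball c₀ r, ∀ x ∈ closedBall x₀ r,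
      HolomorphicAtP (f · y c) x) (k : ℕ) : IsClosed (chartSet f i K x₀ y₀ c₀ r k) := by
  refine isClosed_of_closure_subset fun x hxc => ?_
  have hxr : x ∈ closedBall x₀ r :=
    closure_minimal (fun x hx => hx.1) isClosed_closedBall hxc
  refine ⟨hxr, fun y hy c hc => ?_⟩
  refine (hx y hy c (ball_subset_ball (div_le_self hr (by simp)) hc) x hxr).inPolydisc_of_frequently
    ((mem_closure_iff_frequently.1 hxc).mono fun w hw => hw.2 y hy c hc)

theorem iUnion_chartSet [NormedSpace ℂ E]
    (hy : ∀ x ∈ closedBall x₀ r, ∀ y ∈ closedBall y₀ r,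
      HolomorphicAtP (fun p : ℂ × E => f x p.1 p.2) (y, c₀))
    (h : ∀ x ∈ closedBall x₀ r, ∀ y ∈ closedBall y₀ r, InOpenPolydisc i K (f x y c₀)) :
    ⋃ k, chartSet f i K x₀ y₀ c₀ r k = closedBall x₀ r := by
  refine subset_antisymm (iUnion_subset fun k x hx => hx.1) fun x hx => ?_
  have key : ∀ᶠ c in 𝓝 c₀, ∀ y ∈ closedBall y₀ r, InPolydisc i K (f x y c) := by
    refine (isCompact_closedBall y₀ r).eventually_forall_of_forall_eventually fun y hym => ?_
    have := ((hy x hx y hym).eventually_inOpenPolydisc (h x hx y hym)).mono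
      fun _ => InOpenPolydisc.inPolydisc
    exact (continuous_swap.tendsto (c₀, y)).eventually this
  obtain ⟨ε, hε, hs⟩ := Metric.eventually_nhds_iff_ball.1 key
  obtain ⟨k, hk⟩ := exists_nat_gt (r / ε)
  refine mem_iUnion.2 ⟨k, hx, fun y hym c hc => hs c (ball_subset_ball ?_ hc) y hym⟩
  rw [div_lt_iff₀ hε] at hk
  rw [div_le_iff₀ (by positivity)]
  linarith

/-- A map to projective space which is holomorphic on the slices `y = const` and `x = const`, and on
one slice `c = const`, is jointly holomorphic in `(x, y, c)`. -/
theorem of_separately [NormedSpace ℂ E] {S : Set (ℂ × ℂ × E)} (hS : IsOpen S)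
    (hxc : ∀ x y c, (x, y, c) ∈ S → HolomorphicAtP (fun p : ℂ × E => f p.1 y p.2) (x, c))
    (hyc : ∀ x y c, (x, y, c) ∈ S → HolomorphicAtP (fun p : ℂ × E => f x p.1 p.2) (y, c))
    (hxy : HolomorphicAtP (fun p : ℂ × ℂ => f p.1 p.2 c₀) (x₀, y₀)) (h₀ : (x₀, y₀, c₀) ∈ S) :
    HolomorphicAtP (fun p : ℂ × ℂ × E => f p.1 p.2.1 p.2.2) (x₀, y₀, c₀) := by
  obtain ⟨i, K, hK, hiK⟩ := exists_inOpenPolydisc (f x₀ y₀ c₀)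
  obtain ⟨ε₁, hε₁, hs₁⟩ := Metric.isOpen_iff.1 hS _ h₀
  obtain ⟨ε₂, hε₂, hs₂⟩ := Metric.eventually_nhds_iff_ball.1 (hxy.eventually_inOpenPolydisc hiK)
  obtain ⟨r, hr, hrε⟩ := exists_between (lt_min hε₁ hε₂)
  rw [lt_min_iff] at hrε
  have hmem : ∀ x ∈ closedBall x₀ r, ∀ y ∈ closedBall y₀ r, ∀ c ∈ ball c₀ r, (x, y, c) ∈ S := by
    intro x hx y hy c hc
    rw [mem_closedBall] at hx hy
    rw [mem_ball] at hc
    refine hs₁ ?_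
    rw [mem_ball, Prod.dist_eq, Prod.dist_eq, max_lt_iff, max_lt_iff]
    exact ⟨hx.trans_lt hrε.1, hy.trans_lt hrε.1, hc.trans hrε.1⟩
  have hpoly : ∀ x ∈ closedBall x₀ r, ∀ y ∈ closedBall y₀ r, InOpenPolydisc i K (f x y c₀) := by
    intro x hx y hy
    rw [mem_closedBall] at hx hy
    refine hs₂ (x, y) ?_
    rw [mem_ball, Prod.dist_eq, max_lt_iff]
    exact ⟨hx.trans_lt hrε.2, hy.trans_lt hrε.2⟩
  have hx : ∀ y ∈ closedBall y₀ r, ∀ c ∈ ball c₀ r, ∀ x ∈ closedBall x₀ r,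
      HolomorphicAtP (f · y c) x := fun y hy c hc x hx =>
    (hxc x y c (hmem x hx y hy c hc)).comp (g := fun x => (x, c)) (by fun_prop)
  have hy : ∀ x ∈ closedBall x₀ r, ∀ c ∈ ball c₀ r, ∀ y ∈ closedBall y₀ r,
      HolomorphicAtP (f x · c) y := fun x hx c hc y hy =>
    (hyc x y c (hmem x hx y hy c hc)).comp (g := fun y => (y, c)) (by fun_prop)
  have hc₀ : c₀ ∈ ball c₀ r := mem_ball_self hr
  set A := chartSet f i K x₀ y₀ c₀ r
  set B := chartSet (fun y x c => f x y c) i K y₀ x₀ c₀ r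
  have hAc : ∀ k, IsClosed (A k) := isClosed_chartSet hr.le hx
  have hBc : ∀ k, IsClosed (B k) := isClosed_chartSet hr.le hy
  have hAU : ⋃ k, A k = closedBall x₀ r :=
    iUnion_chartSet (fun x hx y hy => hyc x y c₀ (hmem x hx y hy c₀ hc₀)) hpoly
  have hBU : ⋃ k, B k = closedBall y₀ r :=
    iUnion_chartSet (fun y hy x hx => hxc x y c₀ (hmem x hx y hy c₀ hc₀))
      fun y hy x hx => hpoly x hx y hy
  obtain ⟨a, ha, k₀, ρ, hρ, hρr, hρA⟩ : ∃ a ∈ ball x₀ (r / 8), ∃ k₀ ρ, 0 < ρ ∧ ρ ≤ r / 2 ∧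
      ball a ρ ⊆ A k₀ := by
    have hdense := dense_iUnion_interior_of_closed (f := fun k => A k ∪ (ball x₀ (r / 8))ᶜ)
      (fun k => (hAc k).union isOpen_ball.isClosed_compl) (by
        rw [← iUnion_union, hAU, eq_univ_iff_forall]
        intro x
        by_cases hxm : x ∈ ball x₀ (r / 8)
        · exact Or.inl (ball_subset_closedBall (ball_subset_ball (by linarith) hxm))
        · exact Or.inr hxm)
    obtain ⟨a, ha, haU⟩ := hdense.inter_open_nonempty _ (isOpen_ball (x := x₀) (ε := r / 8))
      ⟨x₀, mem_ball_self (by positivity)⟩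
    obtain ⟨k, hk⟩ := mem_iUnion.1 haU
    obtain ⟨ρ, hρ, hs⟩ := Metric.isOpen_iff.1 (isOpen_interior.inter isOpen_ball) a ⟨hk, ha⟩
    refine ⟨a, ha, k, min ρ (r / 2), by positivity, min_le_right _ _, fun x hxm => ?_⟩
    have h := hs (ball_subset_ball (min_le_left _ _) hxm)
    exact (interior_subset h.1).resolve_right fun h' => h' h.2
  have hOm : ∀ k, MeasurableSet (ball y₀ r \ B k) := fun k =>
    measurableSet_ball.diff (hBc k).measurableSet
  obtain ⟨k, hk₀, hvol⟩ : ∃ k ≥ k₀, ENNReal.ofReal (Real.log (2 / ρ / (2 / r))) *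
      MeasureTheory.volume (ball y₀ r \ B k) ≤
        ENNReal.ofReal (Real.pi * (r / 2) ^ 2 * Real.log 2) := by
    have ht := MeasureTheory.tendsto_measure_iInter_atTop (μ := MeasureTheory.volume)
      (fun k => (hOm k).nullMeasurableSet)
      (fun k k' h => sdiff_subset_sdiff_right (monotone_chartSet hr.le h))
      ⟨0, ((MeasureTheory.measure_mono sdiff_subset).trans_lt
        MeasureTheory.measure_ball_lt_top).ne⟩
    rw [← sdiff_iUnion, hBU, sdiff_eq_empty.2 ball_subset_closedBall, MeasureTheory.measure_empty]
      at ht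
    have ht' := ENNReal.Tendsto.const_mul (a := ENNReal.ofReal (Real.log (2 / ρ / (2 / r)))) ht
      (Or.inr ENNReal.ofReal_ne_top)
    rw [mul_zero] at ht'
    have hpos : 0 < ENNReal.ofReal (Real.pi * (r / 2) ^ 2 * Real.log 2) :=
      ENNReal.ofReal_pos.2 (by have := Real.log_pos one_lt_two; positivity)
    exact ((eventually_ge_atTop k₀).and (ht'.eventually_le_const hpos)).exists
  have hkr : ball c₀ (r / (k + 1)) ⊆ ball c₀ r := ball_subset_ball (div_le_self hr.le (by simp))
  have hbound : ∀ c ∈ ball c₀ (r / (k + 1)), ∀ x ∈ ball x₀ (r / 16), ∀ y ∈ ball y₀ (r / 2),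
      (f x y c).rep i ≠ 0 ∧ ∀ l, ‖affineCoord i l (f x y c)‖ ≤ 4 * K := by
    intro c hc
    refine rep_ne_zero_of_inPolydisc (f := fun x y => f x y c) hK hρ hρr ha
      (fun y hym x hxm => hx y (ball_subset_closedBall hym) c (hkr hc) x
        (ball_subset_closedBall hxm))
      (fun x hxm y hym => hy x (ball_subset_closedBall hxm) c (hkr hc) y
        (ball_subset_closedBall hym))
      (fun x hxm y hym => (monotone_chartSet hr.le hk₀ (hρA hxm)).2 y
        (ball_subset_closedBall hym) c hc) (hOm k) (fun y hym hyO x hxm => ?_) hvol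
    have hyB : y ∈ B k := by
      by_contra h
      exact hyO ⟨hym, h⟩
    exact hyB.2 x (ball_subset_closedBall hxm) c hc
  have hx16 : ball x₀ (r / 16) ⊆ closedBall x₀ r :=
    (ball_subset_ball (by linarith)).trans ball_subset_closedBall
  have hy2 : ball y₀ (r / 2) ⊆ closedBall y₀ r :=
    (ball_subset_ball (by linarith)).trans ball_subset_closedBall
  have hV : ball x₀ (r / 16) ×ˢ ball y₀ (r / 2) ×ˢ ball c₀ (r / (k + 1)) ∈ 𝓝 (x₀, y₀, c₀) :=
    prod_mem_nhds (ball_mem_nhds _ (by positivity))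
      (prod_mem_nhds (ball_mem_nhds _ (by positivity)) (ball_mem_nhds _ (by positivity)))
  refine of_affineCoord (i := i) ?_
  filter_upwards [hV]
  rintro ⟨x, y, c⟩ ⟨hxm, hym, hcm⟩
  refine ⟨(hbound c hcm x hxm y hym).1, fun l => ?_⟩
  obtain ⟨R, hR, hRs⟩ := Metric.isOpen_iff.1 isOpen_ball x hxm
  refine differentiableAt_of_separately (g := fun x (w : ℂ × E) => affineCoord i l (f x w.1 w.2))
    (M := 4 * K) hR ?_ fun x' hx' => ?_
  · filter_upwards [prod_mem_nhds (isOpen_ball.mem_nhds hym) (isOpen_ball.mem_nhds hcm)]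
    rintro ⟨y', c'⟩ ⟨hy', hc'⟩
    refine ⟨fun x' hx' => ?_, fun x' hx' => (hbound c' hc' x' (hRs hx') y' hy').2 l⟩
    exact ((hx y' (hy2 hy') c' (hkr hc') x' (hx16 (hRs hx'))).differentiableAt_affineCoord
      (hbound c' hc' x' (hRs hx') y' hy').1 l).differentiableWithinAt
  · exact (hyc x' y c (hmem x' (hx16 (hRs hx')) y (hy2 hym) c (hkr hcm))).differentiableAt_affineCoord
      (hbound c hcm x' (hRs hx') y hym).1 l

end HolomorphicAtP

section

variable {E : Type} [NormedAddCommGroup E] [NormedSpace ℂ E] {m : ℕ} {S : Set E}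
  {f : E → Projectivization ℂ (Fin (m + 1) → ℂ)}

theorem IsHolomorphicOnP.holomorphicAtP_comp {G : Type*} [NormedAddCommGroup G] [NormedSpace ℂ G]
    (hf : IsHolomorphicOnP S f) {g : G → E} (hg : Differentiable ℂ g) {x : G}
    (hx : ∀ᶠ y in 𝓝 x, g y ∈ S) : HolomorphicAtP (fun y => f (g y)) x := by
  obtain ⟨U, hU, hxU, F, hF, hd, h⟩ := hf (g x) hx.self_of_nhds
  refine ⟨fun y => F (g y), ?_⟩
  filter_upwards [hx, hg.continuous.continuousAt.eventually (hU.mem_nhds hxU)] with y hy hyU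
  exact ⟨(hd.differentiableAt (hU.mem_nhds hyU)).comp y (hg y), hF _ hyU, h _ hyU hy⟩

theorem isHolomorphicOnP_of_holomorphicAtP {g : E → Projectivization ℂ (Fin (m + 1) → ℂ)}
    (hg : ∀ z ∈ S, HolomorphicAtP g z) (hfg : ∀ z ∈ S, f z = g z) : IsHolomorphicOnP S f := by
  intro z hz
  obtain ⟨F, hF⟩ := hg z hz
  obtain ⟨U, hU, hUo, hzU⟩ := _root_.eventually_nhds_iff.1 hF
  exact ⟨U, hUo, hzU, F, fun w hw => (hU w hw).2.1,
    fun w hw => (hU w hw).1.differentiableWithinAt,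
    fun w hw hwS => (hfg w hwS).trans (hU w hw).2.2⟩

end

/-- Holomorphy on coordinate `2`-planes and on coordinate `k`-planes implies holomorphy on
coordinate `(k + 1)`-planes. -/
theorem isHolomorphicOnP_coordPlane_succ {n m k : ℕ} (hk : 2 ≤ k) (hkn : k + 1 ≤ n)
    {Ω : Set (Fin n → ℂ)} (hΩ : IsOpen Ω) {f : (Fin n → ℂ) → Projectivization ℂ (Fin (m + 1) → ℂ)}
    (h2 : ∀ P, IsCoordPlane n 2 P → IsHolomorphicOnP (Ω ∩ P) f)
    (hf : ∀ P, IsCoordPlane n k P → IsHolomorphicOnP (Ω ∩ P) f) {P : Set (Fin n → ℂ)}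
    (hP : IsCoordPlane n (k + 1) P) : IsHolomorphicOnP (Ω ∩ P) f := by
  obtain ⟨I, c, hI, rfl⟩ := hP
  obtain ⟨i, hi, j, hj, hij⟩ : ∃ i ∈ Iᶜ, ∃ j ∈ Iᶜ, i ≠ j := by
    rw [← Finset.one_lt_card, Finset.card_compl, Fintype.card_fin]
    omega
  rw [Finset.mem_compl] at hi hj
  set φ : ℂ → ℂ → (Fin n → ℂ) → Fin n → ℂ := fun x y w l =>
    if l = i then x else if l = j then y else if l ∈ I then c l else w l with hφ
  have hφd : Differentiable ℂ fun p : ℂ × ℂ × (Fin n → ℂ) => φ p.1 p.2.1 p.2.2 := by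
    refine differentiable_pi.2 fun l => ?_
    simp only [hφ]
    split_ifs <;> fun_prop
  have hS : IsOpen {p : ℂ × ℂ × (Fin n → ℂ) | φ p.1 p.2.1 p.2.2 ∈ Ω} :=
    hΩ.preimage hφd.continuous
  have hcard : ∀ {l}, l ∉ I → (insert l I).card = n - k := by
    intro l hl
    rw [Finset.card_insert_of_notMem hl, hI]
    omega
  have hφz : ∀ z ∈ {z | ∀ l ∈ I, z l = c l}, φ (z i) (z j) z = z := by
    intro z hz
    ext l
    simp only [hφ]
    split_ifs with h1 h2 h3
    · rw [h1]
    · rw [h2]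
    · exact (hz l h3).symm
    · rfl
  refine isHolomorphicOnP_of_holomorphicAtP (g := fun z => f (φ (z i) (z j) z)) ?_
    fun z hz => by rw [hφz z hz.2]
  rintro z ⟨hzΩ, hz⟩
  refine HolomorphicAtP.comp (f := fun p : ℂ × ℂ × (Fin n → ℂ) => f (φ p.1 p.2.1 p.2.2))
    (g := fun z => (z i, z j, z)) ?_ (by fun_prop)
  refine HolomorphicAtP.of_separately (f := fun x y w => f (φ x y w)) hS (fun x y w hw => ?_)
    (fun x y w hw => ?_) ?_ (by rwa [mem_ofPred_eq, hφz z hz])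
  · have hd : Differentiable ℂ fun p : ℂ × (Fin n → ℂ) => φ p.1 y p.2 :=
      hφd.comp (f := fun p : ℂ × (Fin n → ℂ) => (p.1, y, p.2)) (by fun_prop)
    refine (hf _ ⟨insert j I, Function.update c j y, hcard hj, rfl⟩).holomorphicAtP_comp hd ?_
    filter_upwards [hd.continuous.continuousAt.eventually (hΩ.mem_nhds hw)] with p hp
    refine ⟨hp, fun l hl => ?_⟩
    rcases Finset.mem_insert.1 hl with rfl | hl
    · simp [hφ, hij.symm]
    · have h1 : l ≠ i := ne_of_mem_of_not_mem hl hi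
      have h2 : l ≠ j := ne_of_mem_of_not_mem hl hj
      simp [hφ, h1, h2, hl]
  · have hd : Differentiable ℂ fun p : ℂ × (Fin n → ℂ) => φ x p.1 p.2 :=
      hφd.comp (f := fun p : ℂ × (Fin n → ℂ) => (x, p.1, p.2)) (by fun_prop)
    refine (hf _ ⟨insert i I, Function.update c i x, hcard hi, rfl⟩).holomorphicAtP_comp hd ?_
    filter_upwards [hd.continuous.continuousAt.eventually (hΩ.mem_nhds hw)] with p hp
    refine ⟨hp, fun l hl => ?_⟩
    rcases Finset.mem_insert.1 hl with rfl | hl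
    · simp [hφ]
    · have h1 : l ≠ i := ne_of_mem_of_not_mem hl hi
      have h2 : l ≠ j := ne_of_mem_of_not_mem hl hj
      simp [hφ, h1, h2, hl]
  · have hd : Differentiable ℂ fun p : ℂ × ℂ => φ p.1 p.2 z :=
      hφd.comp (f := fun p : ℂ × ℂ => (p.1, p.2, z)) (by fun_prop)
    refine (h2 _ ⟨{i, j}ᶜ, z, ?_, rfl⟩).holomorphicAtP_comp hd ?_
    · rw [Finset.card_compl, Finset.card_pair hij, Fintype.card_fin]
    have hw : φ (z i) (z j) z ∈ Ω := by rwa [hφz z hz]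
    filter_upwards [hd.continuous.continuousAt.eventually (hΩ.mem_nhds hw)] with p hp
    refine ⟨hp, fun l hl => ?_⟩
    simp only [Finset.mem_compl, Finset.mem_insert, Finset.mem_singleton, not_or] at hl
    simp only [hφ, hl.1, hl.2, if_false]
    split_ifs with h
    · exact (hz l h).symm
    · rfl

/-- If `n ≥ 3`, `Ω` is an open domain in `ℂⁿ`, and the restriction of `f : Ω → ℙ^m` to
`Ω ∩ Π²` is holomorphic for every coordinate 2-plane `Π²`, then for every `k` with
`3 ≤ k ≤ n` the restriction of `f` to `Ω ∩ Π^k` is holomorphic for every coordinate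
`k`-plane `Π^k`. -/
theorem holomorphic_on_all_coordinate_planes (n m : ℕ) (hn : 3 ≤ n)
    (Ω : Set (Fin n → ℂ)) (hΩopen : IsOpen Ω) (hΩconn : IsConnected Ω)
    (f : (Fin n → ℂ) → Projectivization ℂ (Fin (m + 1) → ℂ))
    (hf : ∀ P : Set (Fin n → ℂ), IsCoordPlane n 2 P → IsHolomorphicOnP (Ω ∩ P) f) :
    ∀ k : ℕ, 3 ≤ k → k ≤ n →
      ∀ P : Set (Fin n → ℂ), IsCoordPlane n k P → IsHolomorphicOnP (Ω ∩ P) f := by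
  intro k hk hkn
  have key : ∀ k, 2 ≤ k → k ≤ n → ∀ P, IsCoordPlane n k P → IsHolomorphicOnP (Ω ∩ P) f := by
    intro k hk
    induction k, hk using Nat.le_induction with
    | base => exact fun _ => hf
    | succ k hk ih =>
      intro hkn P hP
      exact isHolomorphicOnP_coordPlane_succ hk hkn hΩopen hf (ih (by omega)) hP
  exact key k (by omega) hkn
end
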